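/- arXiv:1709.00975 — 5 statements merged into one kernel-verified Lean document; each statement's English description precedes it below -/
import Mathlib

section
/- Let Γ be a handy étale groupoid. Then every periodicoid unit x ∈ Γ⁰ (i.e., every unit whose orbit [x] is closed in Γ⁰) has a finite orbit. Conversely, every finite invariant subset of Γ⁰ is a finite disjoint union of closed orbits of periodicoid units. -/
/-- A topological groupoid, given by a space of arrows `Arr`, a space of objects (units)
`Obj`, range and source maps `r, s`, a unit map `e`, inversion `inv` and a (partial)
composition `comp`, with `r`, `s`, inversion and composition continuous (composition being
defined on the set of composable pairs, equipped with the subspace topology of the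
product). -/
structure TopGroupoid (Arr : Type*) (Obj : Type*)
    [TopologicalSpace Arr] [TopologicalSpace Obj] where
  r : Arr → Obj
  s : Arr → Obj
  e : Obj → Arr
  inv : Arr → Arr
  comp : (γ₁ γ₂ : Arr) → s γ₁ = r γ₂ → Arr
  r_e : ∀ x, r (e x) = x
  s_e : ∀ x, s (e x) = x
  r_comp : ∀ γ₁ γ₂ h, r (comp γ₁ γ₂ h) = r γ₁
  s_comp : ∀ γ₁ γ₂ h, s (comp γ₁ γ₂ h) = s γ₂
  r_inv : ∀ γ, r (inv γ) = s γ
  s_inv : ∀ γ, s (inv γ) = r γ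
  comp_assoc : ∀ γ₁ γ₂ γ₃ (h₁₂ : s γ₁ = r γ₂) (h₂₃ : s γ₂ = r γ₃),
    comp (comp γ₁ γ₂ h₁₂) γ₃ ((s_comp γ₁ γ₂ h₁₂).trans h₂₃)
      = comp γ₁ (comp γ₂ γ₃ h₂₃) (h₁₂.trans (r_comp γ₂ γ₃ h₂₃).symm)
  e_comp : ∀ γ, comp (e (r γ)) γ (s_e (r γ)) = γ
  comp_e : ∀ γ, comp γ (e (s γ)) (r_e (s γ)).symm = γ
  inv_comp : ∀ γ, comp (inv γ) γ (s_inv γ) = e (s γ)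
  comp_inv : ∀ γ, comp γ (inv γ) (r_inv γ).symm = e (r γ)
  continuous_r : Continuous r
  continuous_s : Continuous s
  continuous_inv : Continuous inv
  continuous_comp : Continuous fun q : {q : Arr × Arr // s q.1 = r q.2} => comp q.1.1 q.1.2 q.2

variable {Arr Obj : Type*} [TopologicalSpace Arr] [TopologicalSpace Obj]

/-- A topological groupoid is *handy* if the space of arrows is locally compact, Hausdorff
and second countable, the unit space is compact (and, being identified with the set of
units inside the arrow space, Hausdorff and second countable), and the range and source
maps are open. -/
def TopGroupoid.Handy (G : TopGroupoid Arr Obj) : Prop :=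
  LocallyCompactSpace Arr ∧ T2Space Arr ∧ SecondCountableTopology Arr ∧
    CompactSpace Obj ∧ T2Space Obj ∧ SecondCountableTopology Obj ∧
    IsOpenMap G.r ∧ IsOpenMap G.s

/-- A subset of the unit space is invariant if the source of every arrow whose range lies
in the set also lies in the set. -/
def TopGroupoid.GInvariant (G : TopGroupoid Arr Obj) (M : Set Obj) : Prop :=
  ∀ γ : Arr, G.r γ ∈ M → G.s γ ∈ M

/-- The orbit of a unit `x`: the set of sources of arrows with range `x`. -/
def TopGroupoid.Orbit (G : TopGroupoid Arr Obj) (x : Obj) : Set Obj :=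
  {y | ∃ γ : Arr, G.r γ = x ∧ G.s γ = y}

/-- A topological groupoid is *étale* if every arrow has an open neighbourhood on which
the range map restricts to a homeomorphism onto its image (i.e. an embedding). -/
def TopGroupoid.Etale (G : TopGroupoid Arr Obj) : Prop :=
  ∀ γ : Arr, ∃ U : Set Arr, IsOpen U ∧ γ ∈ U ∧ Topology.IsEmbedding (U.restrict G.r)

namespace TopGroupoid

theorem mem_orbit_self (G : TopGroupoid Arr Obj) (x : Obj) : x ∈ G.Orbit x :=
  ⟨G.e x, G.r_e x, G.s_e x⟩

theorem mem_orbit_symm (G : TopGroupoid Arr Obj) {x y : Obj} (h : y ∈ G.Orbit x) :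
    x ∈ G.Orbit y := by
  obtain ⟨γ, rfl, rfl⟩ := h
  exact ⟨G.inv γ, G.r_inv γ, G.s_inv γ⟩

theorem mem_orbit_trans (G : TopGroupoid Arr Obj) {x y z : Obj} (h : y ∈ G.Orbit x)
    (h' : z ∈ G.Orbit y) : z ∈ G.Orbit x := by
  obtain ⟨γ, rfl, rfl⟩ := h
  obtain ⟨δ, hδ, rfl⟩ := h'
  exact ⟨G.comp γ δ hδ.symm, G.r_comp _ _ _, G.s_comp _ _ _⟩

/-- The equivalence relation on units whose classes are the orbits. -/
def orbitSetoid (G : TopGroupoid Arr Obj) : Setoid Obj where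
  r x y := y ∈ G.Orbit x
  iseqv := ⟨G.mem_orbit_self, G.mem_orbit_symm, G.mem_orbit_trans⟩

theorem Etale.exists_isOpen_injOn {G : TopGroupoid Arr Obj} (hE : G.Etale) (γ : Arr) :
    ∃ U : Set Arr, IsOpen U ∧ γ ∈ U ∧ Set.InjOn G.r U := by
  obtain ⟨U, hU, hγ, h⟩ := hE γ
  exact ⟨U, hU, hγ, Set.injOn_iff_injective.2 h.injective⟩

theorem Etale.countable_orbit [SecondCountableTopology Arr] {G : TopGroupoid Arr Obj}
    (hE : G.Etale) (x : Obj) : (G.Orbit x).Countable := by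
  have : DiscreteTopology (G.r ⁻¹' {x}) := by
    refine discreteTopology_subtype_iff'.2 fun γ hγ => ?_
    obtain ⟨U, hU, hγU, hinj⟩ := hE.exists_isOpen_injOn γ
    refine ⟨U, hU, Set.Subset.antisymm ?_ ?_⟩
    · rintro δ ⟨hδU, hδ⟩
      exact hinj hδU hγU (hδ.trans hγ.symm)
    · rintro _ rfl
      exact ⟨hγU, hγ⟩
  have hc : (G.r ⁻¹' {x}).Countable :=
    Set.countable_coe_iff.1 (TopologicalSpace.separableSpace_iff_countable.1 inferInstance)
  exact hc.image G.s

/-- If one point of an orbit is isolated in the orbit, then the orbit is discrete. -/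
theorem Etale.discreteTopology_orbit {G : TopGroupoid Arr Obj} (hE : G.Etale)
    (hs : IsOpenMap G.s) {x y : Obj} {V : Set Obj} (hV : IsOpen V)
    (hVy : V ∩ G.Orbit x = {y}) : DiscreteTopology (G.Orbit x) := by
  have hy : y ∈ V ∩ G.Orbit x := hVy ▸ Set.mem_singleton y
  refine discreteTopology_subtype_iff'.2 fun z hz => ?_
  obtain ⟨γ, hγr, rfl⟩ := G.mem_orbit_trans (G.mem_orbit_symm hy.2) hz
  obtain ⟨U, hU, hγU, hinj⟩ := hE.exists_isOpen_injOn γ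
  refine ⟨G.s '' (U ∩ G.r ⁻¹' V), hs _ (hU.inter (hV.preimage G.continuous_r)),
    Set.Subset.antisymm ?_ ?_⟩
  · rintro _ ⟨⟨δ, ⟨hδU, hδV⟩, rfl⟩, hδ⟩
    have hδr : G.r δ ∈ V ∩ G.Orbit x :=
      ⟨hδV, G.mem_orbit_trans hδ (G.mem_orbit_symm ⟨δ, rfl, rfl⟩)⟩
    rw [hVy] at hδr
    rw [hinj hδU hγU (hδr.trans hγr.symm)]
    rfl
  · rintro _ rfl
    exact ⟨⟨γ, ⟨hγU, by rw [Set.mem_preimage, hγr]; exact hy.1⟩, rfl⟩, hz⟩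

theorem GInvariant.orbit_subset {G : TopGroupoid Arr Obj} {M : Set Obj} (hM : G.GInvariant M)
    {x : Obj} (hx : x ∈ M) : G.Orbit x ⊆ M := by
  rintro _ ⟨γ, rfl, rfl⟩
  exact hM γ hx

/-- An invariant set is the union of the orbits of a system of representatives. -/
theorem GInvariant.exists_pairwiseDisjoint_orbit {G : TopGroupoid Arr Obj} {M : Set Obj}
    (hM : G.GInvariant M) :
    ∃ S ⊆ M, S.PairwiseDisjoint (fun x => G.Orbit x) ∧ M = ⋃ x ∈ S, G.Orbit x := by
  let rep : Obj → Obj := fun x => (Quotient.mk G.orbitSetoid x).out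
  have hrep (x : Obj) : x ∈ G.Orbit (rep x) := Quotient.mk_out (s := G.orbitSetoid) x
  have hrep_eq {x y : Obj} (h : y ∈ G.Orbit x) : rep x = rep y :=
    congrArg Quotient.out (Quotient.sound (s := G.orbitSetoid) h)
  have hS : rep '' M ⊆ M := by
    rintro _ ⟨x, hx, rfl⟩
    exact hM.orbit_subset hx (G.mem_orbit_symm (hrep x))
  refine ⟨rep '' M, hS, ?_, Set.Subset.antisymm (fun x hx => ?_) ?_⟩
  · rintro _ ⟨x, -, rfl⟩ _ ⟨y, -, rfl⟩ hne
    refine Set.disjoint_left.2 fun z hzx hzy => hne ?_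
    have hx := hrep_eq (G.mem_orbit_trans (G.mem_orbit_symm hzx) (hrep x))
    have hy := hrep_eq (G.mem_orbit_trans (G.mem_orbit_symm hzy) (hrep y))
    exact hx.symm.trans hy
  · exact Set.mem_biUnion (Set.mem_image_of_mem rep hx) (hrep x)
  · exact Set.iUnion₂_subset fun x hx => hM.orbit_subset (hS hx)

end TopGroupoid

/-- A nonempty countable compact subset of a Hausdorff space has an isolated point. -/
theorem IsCompact.exists_isOpen_inter_eq_singleton {X : Type*} [TopologicalSpace X] [T2Space X]
    {K : Set X} (hK : IsCompact K) (hc : K.Countable) (hne : K.Nonempty) :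
    ∃ y, ∃ V : Set X, IsOpen V ∧ V ∩ K = {y} := by
  have : CompactSpace K := isCompact_iff_compactSpace.1 hK
  have : Countable K := hc.to_subtype
  have : Nonempty K := hne.to_subtype
  obtain ⟨y, hy⟩ := nonempty_interior_of_iUnion_of_closed
    (f := fun y : K => ({y} : Set K)) (fun _ => isClosed_singleton) (Set.iUnion_of_singleton K)
  have hopen : IsOpen ({y} : Set K) := by
    rw [← hy.subset_singleton_iff.1 interior_subset]
    exact isOpen_interior
  obtain ⟨V, hV, hVy⟩ := isOpen_induced_iff.1 hopen
  refine ⟨y, V, hV, ?_⟩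
  rw [Set.inter_comm, ← Subtype.image_preimage_coe, hVy, Set.image_singleton]

/-- Let `Γ` be a handy étale groupoid.  Then every periodicoid unit
(i.e. every unit whose orbit is closed in `Γ⁰`) has a finite orbit.  Conversely, every
finite invariant subset of `Γ⁰` is a finite disjoint union of closed orbits of
periodicoid units. -/
theorem periodicoid_orbits_of_etale
    {Arr Obj : Type*} [TopologicalSpace Arr] [TopologicalSpace Obj]
    (G : TopGroupoid Arr Obj) (hG : G.Handy) (hE : G.Etale) :
    (∀ x : Obj, IsClosed (G.Orbit x) → (G.Orbit x).Finite) ∧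
    (∀ M : Set Obj, M.Finite → G.GInvariant M →
      ∃ S : Set Obj, S.Finite ∧ S ⊆ M ∧
        (∀ x ∈ S, IsClosed (G.Orbit x)) ∧
        S.PairwiseDisjoint (fun x => G.Orbit x) ∧
        M = ⋃ x ∈ S, G.Orbit x) := by
  obtain ⟨-, -, _, _, _, -, -, hs⟩ := hG
  refine ⟨fun x hx => ?_, fun M hfin hM => ?_⟩
  · obtain ⟨y, V, hV, hVy⟩ := hx.isCompact.exists_isOpen_inter_eq_singleton
      (hE.countable_orbit x) ⟨x, G.mem_orbit_self x⟩
    exact hx.isCompact.finite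
      (isDiscrete_iff_discreteTopology.2 (hE.discreteTopology_orbit hs hV hVy))
  · obtain ⟨S, hSM, hdisj, hunion⟩ := hM.exists_pairwiseDisjoint_orbit
    exact ⟨S, hfin.subset hSM, hSM,
      fun x hx => (hfin.subset (hM.orbit_subset (hSM hx))).isClosed, hdisj, hunion⟩
end

section
/- Let Γ be a handy groupoid. Then the set I(Γ) of nonempty closed invariant subsets of the unit space Γ⁰ is a closed subset of the space C(Γ⁰) of all nonempty closed subsets of Γ⁰ equipped with the Hausdorff (Vietoris) topology; consequently I(Γ), with the induced topology, is compact, Hausdorff and second countable. -/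
variable {Arr Obj : Type*} [TopologicalSpace Arr] [TopologicalSpace Obj]

/-- The space of nonempty closed subsets of a topological space. -/
abbrev ClosedsNE (X : Type*) [TopologicalSpace X] : Type _ :=
  {A : Set X // A.Nonempty ∧ IsClosed A}

/-- The Hausdorff (Vietoris) topology on the space of nonempty closed subsets: it is
generated by the basic sets `U(F, 𝓕) = {A : A ∩ F = ∅ and A ∩ O ≠ ∅ for all O ∈ 𝓕}`,
where `F` is closed and `𝓕` is a finite family of open sets. -/
instance vietorisTopology (X : Type*) [TopologicalSpace X] :
    TopologicalSpace (ClosedsNE X) :=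
  TopologicalSpace.generateFrom
    {V : Set (ClosedsNE X) | ∃ (F : Set X) (𝓕 : Finset (Set X)),
      IsClosed F ∧ (∀ O ∈ 𝓕, IsOpen O) ∧
      V = {A : ClosedsNE X | A.1 ∩ F = ∅ ∧ ∀ O ∈ 𝓕, (A.1 ∩ O).Nonempty}}

open TopologicalSpace in
/-- In a compact Hausdorff space, the nonempty closed subsets with the Vietoris topology are
homeomorphic to Mathlib's space of nonempty compact subsets. -/
def ClosedsNE.homeomorphNonemptyCompacts (X : Type*) [TopologicalSpace X] [CompactSpace X]
    [T2Space X] : ClosedsNE X ≃ₜ NonemptyCompacts X where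
  toFun A := ⟨⟨A.1, A.2.2.isCompact⟩, A.2.1⟩
  invFun K := ⟨K, K.nonempty, K.isCompact.isClosed⟩
  left_inv _ := rfl
  right_inv _ := rfl
  continuous_toFun := by
    let := TopologicalSpace.vietoris X
    rw [NonemptyCompacts.isEmbedding_coe.continuous_iff, continuous_generateFrom_iff]
    rintro _ (⟨U, hU, rfl⟩ | ⟨U, hU, rfl⟩)
    · refine isOpen_generateFrom_of_mem ⟨Uᶜ, ∅, hU.isClosed_compl, by simp, ?_⟩
      ext A
      simp [← Set.disjoint_iff_inter_eq_empty, Set.disjoint_compl_right_iff_subset]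
    · refine isOpen_generateFrom_of_mem ⟨∅, {U}, isClosed_empty, by simpa using hU, ?_⟩
      ext A
      simp
  continuous_invFun := by
    refine continuous_generateFrom_iff.2 ?_
    rintro _ ⟨F, 𝓕, hF, h𝓕, rfl⟩
    have key : IsOpen ({K : NonemptyCompacts X | (K : Set X) ⊆ Fᶜ} ∩
        ⋂ O ∈ 𝓕, {K : NonemptyCompacts X | ((K : Set X) ∩ O).Nonempty}) :=
      (NonemptyCompacts.isOpen_subsets_of_isOpen hF.isOpen_compl).inter
        (isOpen_biInter_finset fun O hO =>
          NonemptyCompacts.isOpen_inter_nonempty_of_isOpen (h𝓕 O hO))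
    convert key using 1
    ext K
    simp [← Set.disjoint_iff_inter_eq_empty, Set.subset_compl_iff_disjoint_right]

/-- If the range map is open and the unit space is regular, the invariant sets form a closed
subset of the space of nonempty closed subsets of the unit space. -/
theorem TopGroupoid.isClosed_setOf_gInvariant {Arr Obj : Type*} [TopologicalSpace Arr]
    [TopologicalSpace Obj] [RegularSpace Obj] (G : TopGroupoid Arr Obj) (hr : IsOpenMap G.r) :
    IsClosed {A : ClosedsNE Obj | G.GInvariant A.1} := by
  rw [← isOpen_compl_iff, isOpen_iff_forall_mem_open]
  intro A hA
  obtain ⟨γ, hrγ, hsγ⟩ : ∃ γ, G.r γ ∈ A.1 ∧ G.s γ ∉ A.1 := by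
    simpa [TopGroupoid.GInvariant] using hA
  obtain ⟨F, hF, hFc, hFA⟩ :=
    exists_mem_nhds_isClosed_subset (A.2.2.isOpen_compl.mem_nhds hsγ)
  refine ⟨{B | B.1 ∩ F = ∅ ∧ ∀ O ∈ ({G.r '' (G.s ⁻¹' interior F)} : Finset (Set Obj)),
    (B.1 ∩ O).Nonempty}, ?_, TopologicalSpace.isOpen_generateFrom_of_mem ⟨F, _, hFc, ?_, rfl⟩, ?_⟩
  · rintro B ⟨hBF, hBO⟩ hB
    obtain ⟨_, hx, δ, hδ, rfl⟩ := hBO _ (Finset.mem_singleton_self _)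
    exact hBF.subset ⟨hB δ hx, interior_subset hδ⟩
  · simpa using hr _ (isOpen_interior.preimage G.continuous_s)
  · refine ⟨?_, ?_⟩
    · rw [← Set.disjoint_iff_inter_eq_empty, ← Set.subset_compl_iff_disjoint_left]
      exact hFA
    · simpa using ⟨_, hrγ, γ, mem_interior_iff_mem_nhds.2 hF, rfl⟩

/-- Let `Γ` be a handy groupoid.  Then the set `I(Γ)` of nonempty closed
invariant subsets of the unit space is a closed subset of the space `C(Γ⁰)` of nonempty
closed subsets of `Γ⁰` equipped with the Hausdorff (Vietoris) topology; consequently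
`I(Γ)`, with the induced topology, is compact, Hausdorff and second countable. -/
theorem invariantSets_closed_compact_T2_secondCountable
    {Arr Obj : Type*} [TopologicalSpace Arr] [TopologicalSpace Obj]
    (G : TopGroupoid Arr Obj) (hG : G.Handy) :
    IsClosed {A : ClosedsNE Obj | G.GInvariant A.1} ∧
    CompactSpace {A : ClosedsNE Obj // G.GInvariant A.1} ∧
    T2Space {A : ClosedsNE Obj // G.GInvariant A.1} ∧
    SecondCountableTopology {A : ClosedsNE Obj // G.GInvariant A.1} := by
  obtain ⟨-, -, -, _, _, _, hr, -⟩ := hG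
  have hcl := G.isClosed_setOf_gInvariant hr
  let φ := ClosedsNE.homeomorphNonemptyCompacts Obj
  have : CompactSpace (ClosedsNE Obj) := φ.symm.compactSpace
  have : T2Space (ClosedsNE Obj) := φ.isEmbedding.t2Space
  have : SecondCountableTopology (ClosedsNE Obj) := φ.secondCountableTopology
  exact ⟨hcl, hcl.isClosedEmbedding_subtypeVal.compactSpace, inferInstance,
    Topology.IsEmbedding.subtypeVal.secondCountableTopology⟩
end

section
/- Let (Γ, T, p) be a continuous field of handy groupoids with T Hausdorff, and let p₀ : Γ⁰ → T be the restriction of p to the unit space. Then the collection I_T := {M ⊆ Γ⁰ : M = p₀⁻¹({t}) for some t ∈ T} is a closed subset of I(Γ), the set of nonempty closed invariant subsets of Γ⁰ equipped with the Hausdorff (Vietoris) topology. -/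
variable {Arr Obj : Type*} [TopologicalSpace Arr] [TopologicalSpace Obj]

theorem ClosedsNE.isOpen_basic {X : Type*} [TopologicalSpace X] {F O₁ O₂ : Set X}
    (hF : IsClosed F) (h₁ : IsOpen O₁) (h₂ : IsOpen O₂) :
    IsOpen {A : ClosedsNE X | A.1 ∩ F = ∅ ∧ (A.1 ∩ O₁).Nonempty ∧ (A.1 ∩ O₂).Nonempty} := by
  classical
  exact TopologicalSpace.isOpen_generateFrom_of_mem
    ⟨F, {O₁, O₂}, hF, by simp [h₁, h₂], by simp⟩

/-- The fibers of a continuous open map from a regular space to a Hausdorff space form a closed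
set of nonempty closed subsets in the Vietoris topology. -/
theorem ClosedsNE.isClosed_fibers {X T : Type*} [TopologicalSpace X] [RegularSpace X]
    [TopologicalSpace T] [T2Space T] {q : X → T} (hqc : Continuous q) (hqo : IsOpenMap q) :
    IsClosed {A : ClosedsNE X | ∃ t : T, A.1 = q ⁻¹' {t}} := by
  rw [← isOpen_compl_iff, isOpen_iff_forall_mem_open]
  intro A hA
  obtain ⟨x, hx⟩ := A.2.1
  by_cases hconst : ∀ y ∈ A.1, q y = q x
  · obtain ⟨y, hy, hyA⟩ : ∃ y, q y = q x ∧ y ∉ A.1 := by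
      by_contra! h
      exact hA ⟨q x, Set.Subset.antisymm hconst h⟩
    obtain ⟨W, O, hW, hO, hAW, hyO, hWO⟩ :=
      (SeparatedNhds.of_isCompact_isClosed isCompact_singleton A.2.2
        (Set.disjoint_singleton_left.2 hyA)).symm
    have hqO : IsOpen (q ⁻¹' (q '' O)) := (hqo O hO).preimage hqc
    refine ⟨_, ?_, ClosedsNE.isOpen_basic hW.isClosed_compl hqO hqO, ?_⟩
    · rintro B ⟨hBW, ⟨z, hzB, o, ho, hoz⟩, -⟩ ⟨t, ht⟩
      have hoB : o ∈ B.1 := by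
        rw [ht] at hzB ⊢
        exact hoz.trans hzB
      have hoW : o ∈ W := by
        by_contra hoW
        exact (Set.eq_empty_iff_forall_notMem.1 hBW) o ⟨hoB, hoW⟩
      exact Set.disjoint_left.1 hWO hoW ho
    · have hne : (A.1 ∩ q ⁻¹' (q '' O)).Nonempty := ⟨x, hx, y, hyO rfl, hy⟩
      exact ⟨Set.disjoint_iff_inter_eq_empty.1 (Set.disjoint_compl_right_iff_subset.2 hAW),
        hne, hne⟩
  · push Not at hconst
    obtain ⟨y, hy, hyx⟩ := hconst
    obtain ⟨U, V, hU, hV, hyU, hxV, hUV⟩ := t2_separation hyx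
    refine ⟨_, ?_, ClosedsNE.isOpen_basic isClosed_empty (hU.preimage hqc) (hV.preimage hqc), ?_⟩
    · rintro B ⟨-, ⟨a, haB, haU⟩, ⟨b, hbB, hbV⟩⟩ ⟨t, ht⟩
      rw [ht] at haB hbB
      have hab : q a = q b := Eq.trans haB (Eq.symm hbB)
      exact Set.disjoint_left.1 hUV haU (hab ▸ hbV)
    · exact ⟨Set.inter_empty _, ⟨y, hy, hyU⟩, ⟨x, hx, hxV⟩⟩

/-- Let `(Γ, T, p)` be a continuous field of handy groupoids with `T`
Hausdorff (`p : Γ → T` is continuous, open and surjective, and factors through the range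
and source maps via its restriction `p₀ : x ↦ p (eₓ)` to the unit space).  Then the
collection `I_T = {p₀⁻¹{t} : t ∈ T}` is a closed subset of `I(Γ)`, the set of nonempty
closed invariant subsets of `Γ⁰` with the Hausdorff (Vietoris) topology. -/
theorem fibers_closed_in_invariantSets
    {Arr Obj : Type*} [TopologicalSpace Arr] [TopologicalSpace Obj]
    (G : TopGroupoid Arr Obj) (hG : G.Handy)
    {T : Type*} [TopologicalSpace T] [T2Space T]
    (p : Arr → T) (hpc : Continuous p) (hpo : IsOpenMap p) (hps : Function.Surjective p)
    (hpr : ∀ γ : Arr, p γ = p (G.e (G.r γ)))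
    (hpsrc : ∀ γ : Arr, p γ = p (G.e (G.s γ))) :
    IsClosed {A : {B : ClosedsNE Obj // G.GInvariant B.1} |
      ∃ t : T, A.1.1 = (fun x : Obj => p (G.e x)) ⁻¹' {t}} := by
  obtain ⟨-, -, -, _, _, -, hr, -⟩ := hG
  have hrs : Function.Surjective G.r := fun x => ⟨G.e x, G.r_e x⟩
  have hcomp : (fun x : Obj => p (G.e x)) ∘ G.r = p := funext fun γ => (hpr γ).symm
  have hqc : Continuous fun x : Obj => p (G.e x) := by
    rw [(hr.isQuotientMap G.continuous_r hrs).continuous_iff, hcomp]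
    exact hpc
  have hqo : IsOpenMap fun x : Obj => p (G.e x) := by
    intro O hO
    rw [← Set.image_preimage_eq O hrs, ← Set.image_comp, hcomp]
    exact hpo _ (hO.preimage G.continuous_r)
  exact (ClosedsNE.isClosed_fibers hqc hqo).preimage continuous_subtype_val
end

section
/- Let (Γ, T, p) be a continuous field of handy groupoids with T Hausdorff, p₀ : Γ⁰ → T the restriction of p to the unit space, and I_T := {p₀⁻¹({t}) : t ∈ T} ⊆ I(Γ). Then the map p_T : I_T → T defined by p_T(M) = p₀(x) for any x ∈ M is well defined and is a homeomorphism, where I_T carries the Hausdorff (Vietoris) topology. Moreover, the map ι_T : Γ → p_Γ⁻¹(I_T) ⊆ T(Γ) defined by ι_T(γ) = (p₀⁻¹({p(γ)}), γ) is continuous, open and surjective onto the closed subgroupoid p_Γ⁻¹(I_T) of the tautological groupoid T(Γ), and it satisfies p = p_T ∘ p_Γ ∘ ι_T. -/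
variable {Arr Obj : Type*} [TopologicalSpace Arr] [TopologicalSpace Obj]

variable {Arr Obj : Type*} [TopologicalSpace Arr] [TopologicalSpace Obj]

/-- The space `I(Γ)` of nonempty closed invariant subsets of the unit space, with the
topology induced by the Hausdorff (Vietoris) topology. -/
abbrev InvSp (G : TopGroupoid Arr Obj) : Type _ :=
  {A : ClosedsNE Obj // G.GInvariant A.1}

/-- The (arrow space of the) tautological groupoid `T(Γ)`: pairs `(M, γ)` with
`M ∈ I(Γ)` and `r γ ∈ M`, topologized as a subspace of `I(Γ) × Γ`.  Its projection onto
the first coordinate is the map `p_Γ`. -/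
abbrev Taut (G : TopGroupoid Arr Obj) : Type _ :=
  {q : InvSp G × Arr // G.r q.2 ∈ q.1.1.1}

/-- The sets avoiding a given closed set form a Vietoris-open set. -/
theorem ClosedsNE.isOpen_avoiding {X : Type*} [TopologicalSpace X] {F : Set X}
    (hF : IsClosed F) : IsOpen {A : ClosedsNE X | A.1 ∩ F = ∅} :=
  TopologicalSpace.isOpen_generateFrom_of_mem ⟨F, ∅, hF, by simp, by simp⟩

/-- The sets meeting a given open set form a Vietoris-open set. -/
theorem ClosedsNE.isOpen_meeting {X : Type*} [TopologicalSpace X] {O : Set X}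
    (hO : IsOpen O) : IsOpen {A : ClosedsNE X | (A.1 ∩ O).Nonempty} :=
  TopologicalSpace.isOpen_generateFrom_of_mem
    ⟨∅, {O}, isClosed_empty, by simpa using hO, by simp⟩

/-- The Vietoris topology on the closed subsets of a regular space is Hausdorff. -/
theorem ClosedsNE.t2Space {X : Type*} [TopologicalSpace X] [RegularSpace X] :
    T2Space (ClosedsNE X) := by
  have key : ∀ A B : ClosedsNE X, ¬ A.1 ⊆ B.1 →
      ∃ U V : Set (ClosedsNE X), IsOpen U ∧ IsOpen V ∧ A ∈ U ∧ B ∈ V ∧ Disjoint U V := by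
    intro A B h
    obtain ⟨x, hxA, hxB⟩ := Set.not_subset.1 h
    have hsep : SeparatedNhds {x} B.1 :=
      SeparatedNhds.of_isCompact_isClosed isCompact_singleton B.2.2
        (Set.disjoint_singleton_left.2 hxB)
    obtain ⟨U, V, hU, hV, hxU, hBV, hUV⟩ := hsep
    refine ⟨_, _, isOpen_meeting hU, isOpen_avoiding hV.isClosed_compl,
      ⟨x, hxA, Set.singleton_subset_iff.1 hxU⟩, ?_, ?_⟩
    · exact Set.disjoint_iff_inter_eq_empty.1 (Set.disjoint_compl_right_iff_subset.2 hBV)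
    · refine Set.disjoint_left.2 fun M hMU hMV => ?_
      obtain ⟨y, hyM, hyU⟩ := hMU
      have hyV : y ∉ V := Set.disjoint_left.1 hUV hyU
      exact Set.eq_empty_iff_forall_notMem.1 hMV y ⟨hyM, hyV⟩
  refine ⟨fun A B hAB => ?_⟩
  by_cases h : A.1 ⊆ B.1
  · have h' : ¬ B.1 ⊆ A.1 := fun h' => hAB (Subtype.ext (h.antisymm h'))
    obtain ⟨U, V, hU, hV, hBU, hAV, hUV⟩ := key B A h'
    exact ⟨V, U, hV, hU, hAV, hBU, hUV.symm⟩
  · exact key A B h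

/-- The fibres of a continuous, closed, open surjection depend continuously on the base
point. -/
theorem ClosedsNE.continuous_fiber {X T : Type*} [TopologicalSpace X] [TopologicalSpace T]
    {f : X → T} (hclosed : IsClosedMap f) (hopen : IsOpenMap f)
    (hf : ∀ t, (f ⁻¹' {t}).Nonempty ∧ IsClosed (f ⁻¹' {t})) :
    Continuous fun t => (⟨f ⁻¹' {t}, hf t⟩ : ClosedsNE X) := by
  refine continuous_generateFrom_iff.2 ?_
  rintro _ ⟨F, 𝓕, hF, h𝓕, rfl⟩
  have hset : (fun t => (⟨f ⁻¹' {t}, hf t⟩ : ClosedsNE X)) ⁻¹'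
      {A : ClosedsNE X | A.1 ∩ F = ∅ ∧ ∀ O ∈ 𝓕, (A.1 ∩ O).Nonempty} =
      (f '' F)ᶜ ∩ ⋂ O ∈ 𝓕, f '' O := by
    ext t
    simp only [Set.mem_preimage, Set.mem_inter_iff, Set.mem_compl_iff,
      Set.mem_iInter, Set.eq_empty_iff_forall_notMem, Set.Nonempty,
      Set.mem_image, not_exists, not_and]
    refine and_congr (forall_congr' fun x => imp_not_comm) ?_
    exact forall₂_congr fun O _ => exists_congr fun x => and_comm
  rw [hset]
  exact (hclosed F hF).isOpen_compl.inter
    (isOpen_biInter_finset fun O hO => hopen O (h𝓕 O hO))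

/-- Let `(Γ, T, p)` be a continuous field of handy groupoids with `T`
Hausdorff, `p₀ : x ↦ p (eₓ)` the restriction of `p` to the unit space and
`I_T = {p₀⁻¹{t} : t ∈ T} ⊆ I(Γ)`.  Then `p_T : I_T → T`, `M ↦ p₀ x` for any `x ∈ M`, is
well defined and a homeomorphism (`I_T` carrying the Vietoris topology).  Moreover, the
map `ι_T : Γ → p_Γ⁻¹(I_T)`, `γ ↦ (p₀⁻¹{p γ}, γ)`, is continuous, open and surjective onto
the closed subgroupoid `p_Γ⁻¹(I_T)` of the tautological groupoid `T(Γ)`, and it satisfies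
`p = p_T ∘ p_Γ ∘ ι_T`. -/
theorem field_embeds_in_tautological_field
    (G : TopGroupoid Arr Obj) (hG : G.Handy)
    {T : Type*} [TopologicalSpace T] [T2Space T]
    (p : Arr → T) (hpc : Continuous p) (hpo : IsOpenMap p) (hps : Function.Surjective p)
    (hpr : ∀ γ : Arr, p γ = p (G.e (G.r γ)))
    (hpsrc : ∀ γ : Arr, p γ = p (G.e (G.s γ))) :
    ∃ φ : {A : InvSp G // ∃ t : T, A.1.1 = (fun x : Obj => p (G.e x)) ⁻¹' {t}} ≃ₜ T,
      (∀ A x, x ∈ A.1.1.1 → φ A = p (G.e x)) ∧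
      IsClosed {q : Taut G |
        ∃ t : T, q.1.1.1.1 = (fun x : Obj => p (G.e x)) ⁻¹' {t}} ∧
      ∃ ι : Arr →
          {q : Taut G // ∃ t : T, q.1.1.1.1 = (fun x : Obj => p (G.e x)) ⁻¹' {t}},
        Continuous ι ∧ IsOpenMap ι ∧ Function.Surjective ι ∧
        (∀ γ : Arr, (ι γ).1.1.2 = γ) ∧
        (∀ γ : Arr, (ι γ).1.1.1.1.1 = (fun x : Obj => p (G.e x)) ⁻¹' {p γ}) ∧
        (∀ (γ : Arr)
          (h : ∃ t : T, ((ι γ).1.1.1 : InvSp G).1.1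
              = (fun x : Obj => p (G.e x)) ⁻¹' {t}),
          φ ⟨(ι γ).1.1.1, h⟩ = p γ) := by
  obtain ⟨-, -, -, hcomp, hT2, -, hro, -⟩ := hG
  set f : Obj → T := fun x => p (G.e x)
  have hrsurj : Function.Surjective G.r := fun x => ⟨G.e x, G.r_e x⟩
  have hpf : p = f ∘ G.r := funext hpr
  have hfc : Continuous f := by
    rw [(hro.isQuotientMap G.continuous_r hrsurj).continuous_iff, ← hpf]
    exact hpc
  have hfo : IsOpenMap f := by
    refine IsOpenMap.of_comp G.continuous_r hrsurj ?_
    rw [← hpf]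
    exact hpo
  have hfs : Function.Surjective f := fun t => by
    obtain ⟨γ, rfl⟩ := hps t
    exact ⟨G.r γ, (hpr γ).symm⟩
  have hfiber : ∀ t, (f ⁻¹' {t}).Nonempty ∧ IsClosed (f ⁻¹' {t}) := fun t =>
    ⟨hfs t, isClosed_singleton.preimage hfc⟩
  have hinv : ∀ t, G.GInvariant (f ⁻¹' {t}) := fun t γ hγ =>
    ((hpsrc γ).symm.trans (hpr γ)).trans hγ
  let fib : T → InvSp G := fun t => ⟨⟨f ⁻¹' {t}, hfiber t⟩, hinv t⟩
  have hfib : Continuous fib :=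
    (ClosedsNE.continuous_fiber hfc.isClosedMap hfo hfiber).subtype_mk _
  have hval : ∀ (A : {A : InvSp G // ∃ t : T, A.1.1 = f ⁻¹' {t}}) (x : Obj),
      x ∈ A.1.1.1 → A.2.choose = f x := fun A x hx => by
    rw [A.2.choose_spec] at hx
    exact hx.symm
  have hval_cont : Continuous fun A : {A : InvSp G // ∃ t : T, A.1.1 = f ⁻¹' {t}} =>
      A.2.choose := by
    refine continuous_def.2 fun U hU => ?_
    have hset : (fun A : {A : InvSp G // ∃ t : T, A.1.1 = f ⁻¹' {t}} => A.2.choose) ⁻¹' U =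
        {A | A.1.1.1 ∩ f ⁻¹' Uᶜ = ∅} := by
      ext A
      simp only [Set.mem_preimage, Set.mem_ofPred_eq, Set.eq_empty_iff_forall_notMem]
      refine ⟨fun hA x hx => hx.2 (hval A x hx.1 ▸ hA), fun hA => ?_⟩
      obtain ⟨x, hx⟩ := A.1.1.2.1
      by_contra hn
      exact hA x ⟨hx, fun hxU => hn ((hval A x hx).symm ▸ hxU)⟩
    rw [hset]
    exact (ClosedsNE.isOpen_avoiding (hU.isClosed_compl.preimage hfc)).preimage
      (continuous_subtype_val.comp continuous_subtype_val)
  let φ : {A : InvSp G // ∃ t : T, A.1.1 = f ⁻¹' {t}} ≃ₜ T :=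
    { toFun := fun A => A.2.choose
      invFun := fun t => ⟨fib t, t, rfl⟩
      left_inv := fun A => Subtype.ext (Subtype.ext (Subtype.ext A.2.choose_spec.symm))
      right_inv := fun t => by
        obtain ⟨x, hx⟩ := hfs t
        exact (hval ⟨fib t, t, rfl⟩ x hx).trans hx
      continuous_toFun := hval_cont
      continuous_invFun := hfib.subtype_mk _ }
  let ι : Arr → {q : Taut G // ∃ t : T, q.1.1.1.1 = f ⁻¹' {t}} := fun γ =>
    ⟨⟨(fib (p γ), γ), (hpr γ).symm⟩, p γ, rfl⟩
  have hι : ∀ q, ι q.1.1.2 = q := by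
    rintro ⟨⟨⟨M, γ⟩, hγ⟩, t, ht⟩
    have hpt : p γ = t := by
      have hmem : G.r γ ∈ f ⁻¹' {t} := ht ▸ hγ
      exact (hpr γ).trans hmem
    refine Subtype.ext (Subtype.ext (Prod.ext (Subtype.ext (Subtype.ext ?_)) rfl))
    exact (congrArg (fun t => f ⁻¹' {t}) hpt).trans ht.symm
  refine ⟨φ, hval, ?_, ι, ?_, ?_, fun q => ⟨q.1.1.2, hι q⟩, fun _ => rfl, fun _ => rfl, ?_⟩
  · have : CompactSpace T := hfs.compactSpace hfc
    have : T2Space (ClosedsNE Obj) := ClosedsNE.t2Space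
    have hset : {q : Taut G | ∃ t : T, q.1.1.1.1 = f ⁻¹' {t}} =
        (fun q : Taut G => q.1.1) ⁻¹' Set.range fib := by
      ext q
      exact exists_congr fun t =>
        ⟨fun h => Subtype.ext (Subtype.ext h.symm), fun h => congrArg (fun M : InvSp G => M.1.1) h.symm⟩
    rw [hset]
    exact (isCompact_range hfib).isClosed.preimage
      (continuous_fst.comp continuous_subtype_val)
  · exact (((hfib.comp hpc).prodMk continuous_id).subtype_mk _).subtype_mk _
  · exact IsOpenMap.of_inverse
      (continuous_snd.comp (continuous_subtype_val.comp continuous_subtype_val))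
      hι (fun _ => rfl)
  · intro γ h
    exact (hval ⟨_, h⟩ (G.r γ) (hpr γ).symm).trans (hpr γ).symm
end

section
/- Let X be a compact Hausdorff space, and let h : X → [0,1] be a function (not assumed continuous) for which there exists x₀ ∈ X such that h(x₀) = 0 and h is continuous at x₀. Then there exists a continuous function h̃ : X → [0,1] such that h̃(x₀) = 0 and h(x) ≤ h̃(x) for all x ∈ X. -/
theorem ContinuousAt.exists_continuous_eq_one_of_le {X : Type*} [TopologicalSpace X]
    [CompletelyRegularSpace X] {h : X → ℝ} {x₀ : X} (hcont : ContinuousAt h x₀) {ε : ℝ}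
    (hε : h x₀ < ε) :
    ∃ g : X → ℝ, Continuous g ∧ (∀ x, g x ∈ Set.Icc (0 : ℝ) 1) ∧ g x₀ = 0 ∧
      ∀ x, ε ≤ h x → g x = 1 := by
  have hU : x₀ ∈ interior {x | h x < ε} :=
    mem_interior_iff_mem_nhds.2 (hcont.eventually_lt_const hε)
  obtain ⟨f, hf, hf₀, hf₁⟩ := CompletelyRegularSpace.completely_regular x₀
    (interior {x | h x < ε})ᶜ isOpen_interior.isClosed_compl (by simpa using hU)
  refine ⟨fun x => f x, continuous_subtype_val.comp hf, fun x => (f x).2, by simp [hf₀],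
    fun x hx => ?_⟩
  have hfx : f x = 1 := hf₁ fun hx' => by
    have : x ∈ {x | h x < ε} := interior_subset hx'
    exact hx.not_gt this
  simp [hfx]

/-- Let `X` be a compact Hausdorff space and `h : X → [0,1]` a (not
necessarily continuous) function such that `h x₀ = 0` and `h` is continuous at `x₀`.
Then there is a continuous `h̃ : X → [0,1]` with `h̃ x₀ = 0` and `h ≤ h̃`. -/
theorem exists_continuous_majorant {X : Type*} [TopologicalSpace X] [CompactSpace X]
    [T2Space X] (h : X → ℝ) (hmem : ∀ x, h x ∈ Set.Icc (0 : ℝ) 1) (x₀ : X)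
    (hx₀ : h x₀ = 0) (hcont : ContinuousAt h x₀) :
    ∃ htilde : X → ℝ, Continuous htilde ∧ (∀ x, htilde x ∈ Set.Icc (0 : ℝ) 1) ∧
      htilde x₀ = 0 ∧ ∀ x, h x ≤ htilde x := by
  choose g hg hg01 hg₀ hg₁ using fun n : ℕ =>
    hcont.exists_continuous_eq_one_of_le (ε := 1 / 2 / 2 ^ n) (by rw [hx₀]; positivity)
  have hw : HasSum (fun n : ℕ => (1 : ℝ) / 2 / 2 ^ n) 1 := hasSum_geometric_two' 1
  have hnonneg : ∀ n x, 0 ≤ (1 : ℝ) / 2 / 2 ^ n * g n x := fun n x =>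
    mul_nonneg (by positivity) (hg01 n x).1
  have hle : ∀ n x, (1 : ℝ) / 2 / 2 ^ n * g n x ≤ 1 / 2 / 2 ^ n := fun n x =>
    mul_le_of_le_one_right (by positivity) (hg01 n x).2
  have hsum : ∀ x, Summable fun n => (1 : ℝ) / 2 / 2 ^ n * g n x := fun x =>
    hw.summable.of_nonneg_of_le (fun n => hnonneg n x) fun n => hle n x
  refine ⟨fun x => ∑' n, 1 / 2 / 2 ^ n * g n x, ?_, fun x => ⟨?_, ?_⟩, ?_, fun x => ?_⟩
  · refine continuous_tsum (fun n => continuous_const.mul (hg n)) hw.summable fun n x => ?_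
    rw [Real.norm_of_nonneg (hnonneg n x)]
    exact hle n x
  · exact tsum_nonneg fun n => hnonneg n x
  · exact ((hsum x).tsum_le_tsum (fun n => hle n x) hw.summable).trans_eq hw.tsum_eq
  · simp [hg₀]
  · rcases (hmem x).1.eq_or_lt with hx | hx
    · rw [← hx]
      exact tsum_nonneg fun n => hnonneg n x
    classical
    have hex : ∃ n : ℕ, (1 : ℝ) / 2 / 2 ^ n ≤ h x :=
      (hw.summable.tendsto_atTop_zero.eventually_le_const hx).exists
    obtain ⟨N, hN, hmin⟩ : ∃ N : ℕ, (1 : ℝ) / 2 / 2 ^ N ≤ h x ∧ h x ≤ 1 / 2 ^ N := by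
      refine ⟨Nat.find hex, Nat.find_spec hex, ?_⟩
      rcases hk : Nat.find hex with _ | k
      · simpa using (hmem x).2
      · have := Nat.find_min hex (m := k) (by omega)
        rw [pow_succ', ← div_div]
        exact (not_le.1 this).le
    have htail : ∀ n, (1 : ℝ) / 2 / 2 ^ (n + N) * g (n + N) x = 1 / 2 ^ N / 2 / 2 ^ n := by
      intro n
      rw [hg₁ (n + N) x (le_trans (by gcongr <;> simp) hN), pow_add]
      field_simp
    calc h x ≤ 1 / 2 ^ N := hmin
      _ = ∑' n, 1 / 2 / 2 ^ (n + N) * g (n + N) x := by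
        simp_rw [htail]
        exact (tsum_geometric_two' _).symm
      _ ≤ ∑' n, 1 / 2 / 2 ^ n * g n x := by
        rw [← (hsum x).sum_add_tsum_nat_add N]
        exact le_add_of_nonneg_left (Finset.sum_nonneg fun n _ => hnonneg n x)
end
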